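/- arXiv:2202.01601 — 7 statements merged into one kernel-verified Lean document; each statement's English description precedes it below -/
import Mathlib

section
/- Coercivity of the unweighted (energy) bilinear form for the shift problem: for every continuously differentiable function v : [0,2] → ℝ with v(0) = v(2) = 0 one has B(v,v) ≥ ε²∫₀² v′(x)² dx + γ∫₀² v(x)² dx, where B(u,v) := ε²∫₀² u′(x)v′(x) dx + ∫₀² a(x)u(x)v(x) dx + ∫₁² b(x)u(x−1)v(x) dx. -/
open Real Set

/-- Coercivity of the unweighted (energy) bilinear form for the shift problem. -/
theorem energy_coercivity
    (ε α γ : ℝ) (hε : ε ∈ Set.Ioc (0:ℝ) 1) (hα : 0 < α) (hγ : 0 < γ)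
    (a b : ℝ → ℝ) (ha_cont : ContinuousOn a (Set.Icc 0 2))
    (hb_cont : ContinuousOn b (Set.Icc 0 2))
    (ha : ∀ x ∈ Set.Icc (0:ℝ) 2, α ^ 2 ≤ a x)
    (hb : γ ≤ α ^ 2 - sSup ((fun x => |b x|) '' Set.Icc (0:ℝ) 2))
    (v : ℝ → ℝ) (hv : ContDiff ℝ 1 v) (hv0 : v 0 = 0) (hv2 : v 2 = 0) :
    ε ^ 2 * (∫ x in (0:ℝ)..2, (deriv v x) ^ 2) + γ * (∫ x in (0:ℝ)..2, (v x) ^ 2)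
      ≤ ε ^ 2 * (∫ x in (0:ℝ)..2, deriv v x * deriv v x)
        + (∫ x in (0:ℝ)..2, a x * v x * v x)
        + (∫ x in (1:ℝ)..2, b x * v (x - 1) * v x) := by
  set M := sSup ((fun x => |b x|) '' Set.Icc (0:ℝ) 2) with hM
  have hbdd : BddAbove ((fun x => |b x|) '' Set.Icc (0:ℝ) 2) :=
    (isCompact_Icc.image_of_continuousOn hb_cont.abs).bddAbove
  have hbM : ∀ x ∈ Set.Icc (0:ℝ) 2, |b x| ≤ M := fun x hx =>
    le_csSup hbdd ⟨x, hx, rfl⟩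
  have hM0 : 0 ≤ M := (abs_nonneg (b 0)).trans (hbM 0 ⟨le_refl _, by norm_num⟩)
  have hvc : Continuous v := hv.continuous
  have hsq : ∀ p q : ℝ, IntervalIntegrable (fun x => v x ^ 2) MeasureTheory.volume p q :=
    fun p q => (hvc.pow 2).intervalIntegrable p q
  have hA : α ^ 2 * (∫ x in (0:ℝ)..2, (v x) ^ 2) ≤ ∫ x in (0:ℝ)..2, a x * v x * v x := by
    rw [← intervalIntegral.integral_const_mul]
    apply intervalIntegral.integral_mono_on (by norm_num) ((hsq 0 2).const_mul _)
    · apply ContinuousOn.intervalIntegrable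
      rw [Set.uIcc_of_le (by norm_num)]
      exact (ha_cont.mul hvc.continuousOn).mul hvc.continuousOn
    · intro x hx
      nlinarith [ha x hx, sq_nonneg (v x)]
  have hs : Continuous (fun x : ℝ => v (x - 1)) := hvc.comp (continuous_id.sub continuous_const)
  have hB : (-(M / 2)) * (∫ x in (1:ℝ)..2, (v (x - 1) ^ 2 + v x ^ 2))
      ≤ ∫ x in (1:ℝ)..2, b x * v (x - 1) * v x := by
    rw [← intervalIntegral.integral_const_mul]
    apply intervalIntegral.integral_mono_on (by norm_num)
    · exact (((hs.pow 2).add (hvc.pow 2)).const_mul _).intervalIntegrable _ _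
    · apply ContinuousOn.intervalIntegrable
      rw [Set.uIcc_of_le (by norm_num)]
      exact ((hb_cont.mono (Set.Icc_subset_Icc (by norm_num) le_rfl)).mul
        hs.continuousOn).mul hvc.continuousOn
    · intro x hx
      have h := abs_le.1 (hbM x ⟨by linarith [hx.1], hx.2⟩)
      nlinarith [mul_nonneg (sub_nonneg.2 h.2) (sq_nonneg (v (x - 1) - v x)),
        mul_nonneg (neg_le_iff_add_nonneg.1 h.1) (sq_nonneg (v (x - 1) + v x))]
  have hC : (∫ x in (1:ℝ)..2, (v (x - 1) ^ 2 + v x ^ 2)) = ∫ x in (0:ℝ)..2, (v x) ^ 2 := by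
    have hs2 : IntervalIntegrable (fun x => v (x - 1) ^ 2) MeasureTheory.volume 1 2 :=
      (hs.pow 2).intervalIntegrable _ _
    rw [intervalIntegral.integral_add hs2 (hsq 1 2),
      intervalIntegral.integral_comp_sub_right (fun x => v x ^ 2) 1]
    norm_num
    exact intervalIntegral.integral_add_adjacent_intervals (hsq 0 1) (hsq 1 2)
  have hI : 0 ≤ ∫ x in (0:ℝ)..2, (v x) ^ 2 :=
    intervalIntegral.integral_nonneg (by norm_num) (fun x _ => sq_nonneg _)
  rw [hC] at hB
  have hD : (∫ x in (0:ℝ)..2, deriv v x * deriv v x) = ∫ x in (0:ℝ)..2, (deriv v x) ^ 2 := by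
    simp only [pow_two]
  rw [hD]
  nlinarith [mul_nonneg (sub_nonneg.2 hb) hI, mul_nonneg hM0 hI]
end

section
/- Coercivity of the weighted bilinear form (Lemma 2.1): suppose β : [0,2] → ℝ is differentiable with β(x) ≥ 1 and |β′(x)| ≤ (α/ε)β(x) for all x ∈ [0,2], and additionally β(x) ≤ β(x−1) for all x ∈ (1,2). Then for every continuously differentiable v : [0,2] → ℝ with v(0) = v(2) = 0 one has B_β(v,v) ≥ (1/2)(ε²∫₀² β(x)v′(x)² dx + γ∫₀² β(x)v(x)² dx). -/
open Real Set

/-- Coercivity of the weighted bilinear form (Lemma 2.1). -/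
theorem weighted_coercivity
    (ε α γ : ℝ) (hε : ε ∈ Set.Ioc (0:ℝ) 1) (hα : 0 < α) (hγ : 0 < γ)
    (a b : ℝ → ℝ) (ha_cont : ContinuousOn a (Set.Icc 0 2))
    (hb_cont : ContinuousOn b (Set.Icc 0 2))
    (ha : ∀ x ∈ Set.Icc (0:ℝ) 2, α ^ 2 ≤ a x)
    (hb : γ ≤ α ^ 2 - sSup ((fun x => |b x|) '' Set.Icc (0:ℝ) 2))
    (β : ℝ → ℝ) (hβ_diff : Differentiable ℝ β)
    (hβ1 : ∀ x ∈ Set.Icc (0:ℝ) 2, 1 ≤ β x)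
    (hβ' : ∀ x ∈ Set.Icc (0:ℝ) 2, |deriv β x| ≤ α / ε * β x)
    (hβ_shift : ∀ x ∈ Set.Ioo (1:ℝ) 2, β x ≤ β (x - 1))
    (v : ℝ → ℝ) (hv : ContDiff ℝ 1 v) (hv0 : v 0 = 0) (hv2 : v 2 = 0) :
    1 / 2 * (ε ^ 2 * (∫ x in (0:ℝ)..2, β x * (deriv v x) ^ 2)
        + γ * (∫ x in (0:ℝ)..2, β x * (v x) ^ 2))
      ≤ ε ^ 2 * (∫ x in (0:ℝ)..2, deriv v x * deriv (fun y => β y * v y) x)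
        + (∫ x in (0:ℝ)..2, a x * v x * v x * β x)
        + (∫ x in (1:ℝ)..2, b x * v (x - 1) * v x * β x) := by
  obtain ⟨hε0, -⟩ := hε
  set M := sSup ((fun x => |b x|) '' Set.Icc (0:ℝ) 2) with hM
  have hbM : ∀ x ∈ Set.Icc (0:ℝ) 2, |b x| ≤ M := fun x hx =>
    le_csSup (isCompact_Icc.image_of_continuousOn hb_cont.abs).bddAbove ⟨x, hx, rfl⟩
  have hβc : Continuous β := hβ_diff.continuous
  have hvc : Continuous v := hv.continuous
  have hv'c : Continuous (deriv v) := hv.continuous_deriv le_rfl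
  have hvd : Differentiable ℝ v := hv.differentiable (by norm_num)
  have hGi : IntervalIntegrable (fun x => β x * (deriv v x) ^ 2) MeasureTheory.volume 0 2 :=
    (by fun_prop : Continuous (fun x => β x * (deriv v x) ^ 2)).intervalIntegrable _ _
  have hHc : Continuous (fun x => β x * (v x) ^ 2) := by fun_prop
  have hHi := fun p q : ℝ => hHc.intervalIntegrable (μ := MeasureTheory.volume) p q
  have hder : ∀ x, deriv (fun y => β y * v y) x = deriv β x * v x + β x * deriv v x := fun x =>
    deriv_fun_mul (hβ_diff x) (hvd x)
  have hβ'i : IntervalIntegrable (deriv β) MeasureTheory.volume 0 2 := by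
    refine IntervalIntegrable.mono_fun
      ((by fun_prop : Continuous (fun x => α / ε * β x)).intervalIntegrable _ _)
      (measurable_deriv β).aestronglyMeasurable ?_
    refine (MeasureTheory.ae_restrict_iff' measurableSet_uIoc).2 (Filter.Eventually.of_forall ?_)
    intro x hx
    rw [Set.uIoc_of_le (by norm_num)] at hx
    exact (hβ' x ⟨hx.1.le, hx.2⟩).trans (le_abs_self _)
  have hDi : IntervalIntegrable (fun x => deriv v x * deriv (fun y => β y * v y) x)
      MeasureTheory.volume 0 2 := by
    have h1 : IntervalIntegrable (fun x => deriv β x * (v x * deriv v x))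
        MeasureTheory.volume 0 2 :=
      hβ'i.mul_continuousOn (by fun_prop : Continuous (fun x => v x * deriv v x)).continuousOn
    refine (h1.add hGi).congr ?_
    intro x _
    simp only [hder]
    ring
  have e1 : ε ^ 2 / 2 * (∫ x in (0:ℝ)..2, β x * (deriv v x) ^ 2)
      - α ^ 2 / 2 * (∫ x in (0:ℝ)..2, β x * (v x) ^ 2)
      ≤ ε ^ 2 * (∫ x in (0:ℝ)..2, deriv v x * deriv (fun y => β y * v y) x) := by
    rw [← intervalIntegral.integral_const_mul, ← intervalIntegral.integral_const_mul,
      ← intervalIntegral.integral_const_mul, ← intervalIntegral.integral_sub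
        (hGi.const_mul _) ((hHi 0 2).const_mul _)]
    refine intervalIntegral.integral_mono_on (by norm_num)
      ((hGi.const_mul _).sub ((hHi 0 2).const_mul _)) (hDi.const_mul _) ?_
    intro x hx
    rw [hder]
    have hb0 : 0 ≤ β x := zero_le_one.trans (hβ1 x hx)
    have h1 : ε * |deriv β x| ≤ α * β x := by
      have := mul_le_mul_of_nonneg_left (hβ' x hx) hε0.le
      calc _ ≤ _ := this
        _ = _ := by field_simp
    have h2 : |ε ^ 2 * (deriv β x * v x * deriv v x)| ≤
        (α * β x) * (ε * (|v x| * |deriv v x|)) := by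
      have : |ε ^ 2 * (deriv β x * v x * deriv v x)| =
          (ε * |deriv β x|) * (ε * (|v x| * |deriv v x|)) := by
        rw [abs_mul, abs_mul, abs_mul, abs_of_pos (pow_pos hε0 2)]; ring
      rw [this]
      exact mul_le_mul_of_nonneg_right h1 (by positivity)
    have h3 := neg_le_of_abs_le h2
    have h4 := mul_nonneg hb0 (sq_nonneg (α * |v x| - ε * |deriv v x|))
    have h5 := sq_abs (v x)
    have h6 := sq_abs (deriv v x)
    have h7 : β x * (α * |v x| - ε * |deriv v x|) ^ 2 = α ^ 2 * (β x * v x ^ 2)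
        + ε ^ 2 * (β x * deriv v x ^ 2) - 2 * ((α * β x) * (ε * (|v x| * |deriv v x|))) := by
      rw [← h5, ← h6]; ring
    linarith
  have e2 : α ^ 2 * (∫ x in (0:ℝ)..2, β x * (v x) ^ 2)
      ≤ ∫ x in (0:ℝ)..2, a x * v x * v x * β x := by
    rw [← intervalIntegral.integral_const_mul]
    refine intervalIntegral.integral_mono_on (by norm_num) ((hHi 0 2).const_mul _) ?_ ?_
    · apply ContinuousOn.intervalIntegrable
      rw [Set.uIcc_of_le (by norm_num)]
      fun_prop
    · intro x hx
      have hb0 : 0 ≤ β x := zero_le_one.trans (hβ1 x hx)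
      have := mul_le_mul_of_nonneg_right (ha x hx) (mul_nonneg hb0 (sq_nonneg (v x)))
      linarith
  have hM0 : 0 ≤ M := (abs_nonneg _).trans (hbM 0 (by norm_num))
  have hSi : IntervalIntegrable (fun x => β (x - 1) * (v (x - 1)) ^ 2)
      MeasureTheory.volume 1 2 :=
    (by fun_prop : Continuous (fun x => β (x - 1) * (v (x - 1)) ^ 2)).intervalIntegrable _ _
  have hshift : (∫ x in (1:ℝ)..2, β (x - 1) * (v (x - 1)) ^ 2)
      = ∫ x in (0:ℝ)..1, β x * (v x) ^ 2 := by
    rw [intervalIntegral.integral_comp_sub_right (fun x => β x * (v x) ^ 2) 1]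
    norm_num
  have hadd := intervalIntegral.integral_add_adjacent_intervals (hHi 0 1) (hHi 1 2)
  have e3 : -(M / 2) * ((∫ x in (1:ℝ)..2, β (x - 1) * (v (x - 1)) ^ 2)
      + ∫ x in (1:ℝ)..2, β x * (v x) ^ 2)
      ≤ ∫ x in (1:ℝ)..2, b x * v (x - 1) * v x * β x := by
    rw [← intervalIntegral.integral_add hSi (hHi 1 2), ← intervalIntegral.integral_const_mul]
    refine intervalIntegral.integral_mono_on_of_le_Ioo (by norm_num)
      ((hSi.add (hHi 1 2)).const_mul _) ?_ ?_
    · apply ContinuousOn.intervalIntegrable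
      rw [Set.uIcc_of_le (by norm_num)]
      have : ContinuousOn b (Set.Icc 1 2) :=
        hb_cont.mono (Set.Icc_subset_Icc_left (by norm_num))
      fun_prop
    · intro x hx
      have hx' : x ∈ Set.Icc (0:ℝ) 2 := ⟨by linarith [hx.1], hx.2.le⟩
      have hb0 : 0 ≤ β x := zero_le_one.trans (hβ1 x hx')
      have h2 : |b x * v (x - 1) * v x * β x| ≤ M * (|v (x - 1)| * |v x| * β x) := by
        have : |b x * v (x - 1) * v x * β x| = |b x| * (|v (x - 1)| * |v x| * β x) := by
          rw [abs_mul, abs_mul, abs_mul, abs_of_nonneg hb0]; ring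
        rw [this]
        exact mul_le_mul_of_nonneg_right (hbM x hx') (by positivity)
      have h3 := neg_le_of_abs_le h2
      have h4 := mul_nonneg (mul_nonneg hM0 hb0) (sq_nonneg (|v (x - 1)| - |v x|))
      have h5 := mul_le_mul_of_nonneg_left (mul_le_mul_of_nonneg_right (hβ_shift x hx)
        (sq_nonneg (v (x - 1)))) hM0
      have h7 : M * β x * (|v (x - 1)| - |v x|) ^ 2 = M * (β x * v (x - 1) ^ 2)
          + M * (β x * v x ^ 2) - 2 * (M * (|v (x - 1)| * |v x| * β x)) := by
        rw [← sq_abs (v (x - 1)), ← sq_abs (v x)]; ring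
      linarith
  rw [hshift, hadd] at e3
  have hH0 : 0 ≤ ∫ x in (0:ℝ)..2, β x * (v x) ^ 2 :=
    intervalIntegral.integral_nonneg (by norm_num) fun x hx =>
      mul_nonneg (zero_le_one.trans (hβ1 x hx)) (sq_nonneg _)
  have e4 := mul_le_mul_of_nonneg_right hb hH0
  linarith
end

section
/- Weighted cross-term estimate used in the coercivity proof: if β : [0,2] → ℝ is differentiable with β(x) ≥ 0 and |β′(x)| ≤ (α/ε)β(x) for all x ∈ [0,2], then for every continuously differentiable v : [0,2] → ℝ one has |ε²∫₀² v′(x)β′(x)v(x) dx| ≤ (ε²/2)∫₀² β(x)v′(x)² dx + (α²/2)∫₀² β(x)v(x)² dx. -/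
open Real Set

/-- Weighted cross-term estimate used in the coercivity proof. -/
theorem weighted_cross_term_estimate
    (ε α : ℝ) (hε : 0 < ε) (hα : 0 < α)
    (β : ℝ → ℝ) (hβ_diff : Differentiable ℝ β)
    (hβ0 : ∀ x ∈ Set.Icc (0:ℝ) 2, 0 ≤ β x)
    (hβ' : ∀ x ∈ Set.Icc (0:ℝ) 2, |deriv β x| ≤ α / ε * β x)
    (v : ℝ → ℝ) (hv : ContDiff ℝ 1 v) :
    |ε ^ 2 * (∫ x in (0:ℝ)..2, deriv v x * deriv β x * v x)|
      ≤ ε ^ 2 / 2 * (∫ x in (0:ℝ)..2, β x * (deriv v x) ^ 2)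
        + α ^ 2 / 2 * (∫ x in (0:ℝ)..2, β x * (v x) ^ 2) := by
  have hcβ : Continuous β := hβ_diff.continuous
  have hcv : Continuous v := hv.continuous
  have hcv' : Continuous (deriv v) := hv.continuous_deriv le_rfl
  have hi1 : IntervalIntegrable (fun x => ε ^ 2 / 2 * (β x * (deriv v x) ^ 2))
      MeasureTheory.volume 0 2 := Continuous.intervalIntegrable (by fun_prop) _ _
  have hi2 : IntervalIntegrable (fun x => α ^ 2 / 2 * (β x * (v x) ^ 2))
      MeasureTheory.volume 0 2 := Continuous.intervalIntegrable (by fun_prop) _ _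
  rw [← intervalIntegral.integral_const_mul, ← intervalIntegral.integral_const_mul,
    ← intervalIntegral.integral_const_mul, ← intervalIntegral.integral_add hi1 hi2,
    ← Real.norm_eq_abs]
  refine intervalIntegral.norm_integral_le_of_norm_le (by norm_num) ?_ (hi1.add hi2)
  refine Filter.Eventually.of_forall fun x hx => ?_
  have hx' : x ∈ Set.Icc (0:ℝ) 2 := ⟨hx.1.le, hx.2⟩
  have h0 := hβ0 x hx'
  have h1 := hβ' x hx'
  rw [Real.norm_eq_abs, abs_mul, abs_mul, abs_mul, abs_of_nonneg (sq_nonneg ε)]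
  calc ε ^ 2 * (|deriv v x| * |deriv β x| * |v x|)
      ≤ ε ^ 2 * (|deriv v x| * (α / ε * β x) * |v x|) := by gcongr
    _ = β x * ((ε * |deriv v x|) * (α * |v x|)) := by field_simp
    _ ≤ β x * (((ε * |deriv v x|) ^ 2 + (α * |v x|) ^ 2) / 2) := by
        gcongr
        nlinarith [sq_nonneg (ε * |deriv v x| - α * |v x|)]
    _ = ε ^ 2 / 2 * (β x * (deriv v x) ^ 2) + α ^ 2 / 2 * (β x * (v x) ^ 2) := by
        rw [mul_pow, mul_pow, sq_abs, sq_abs]; ring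
end

section
/- The weighted norm with the balanced weight is balanced for boundary layer functions (Remark 2.1): there exist constants c > 0 and C > 0 depending only on α and γ (not on ε) such that for all ε ∈ (0,1], the boundary layer function w(x) = e^{−αx/ε} satisfies c ≤ ε²∫₀² β_b(x)w′(x)² dx + γ∫₀² β_b(x)w(x)² dx ≤ C, where β_b(x) := 1 + (1/ε)(e^{−αx/ε} + e^{−α|x−1|/ε} + e^{−α(2−x)/ε}). In particular one may take c = (α/3)(1 − e^{−6α}) as lower bound. -/
open Real Set

theorem aux_int (k : ℝ) (hk : 0 < k) :
    ∫ x in (0:ℝ)..2, Real.exp (-(k * x)) = (1 - Real.exp (-(k * 2))) / k := by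
  have h : ∀ x ∈ Set.uIcc (0:ℝ) 2,
      HasDerivAt (fun y => - Real.exp (-(k * y)) / k) (Real.exp (-(k * x))) x := by
    intro x _
    have h1 : HasDerivAt (fun y : ℝ => -(k * y)) (-(k * 1)) x :=
      ((hasDerivAt_id x).const_mul k).neg
    refine (h1.exp.neg.div_const k).congr_deriv ?_
    field_simp
  rw [intervalIntegral.integral_eq_sub_of_hasDerivAt h
    (Continuous.intervalIntegrable (by fun_prop) _ _)]
  simp
  ring

theorem aux_bounds (α ε : ℝ) (hα : 0 < α) (hε : 0 < ε) (hε1 : ε ≤ 1) :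
    (1 - Real.exp (-(6 * α))) / (3 * α) ≤ (∫ x in (0:ℝ)..2,
              (1 + 1 / ε * (Real.exp (-(α * x) / ε) + Real.exp (-(α * |x - 1|) / ε)
                + Real.exp (-(α * (2 - x)) / ε)))
              * (Real.exp (-(α * x) / ε)) ^ 2) ∧
    (∫ x in (0:ℝ)..2,
              (1 + 1 / ε * (Real.exp (-(α * x) / ε) + Real.exp (-(α * |x - 1|) / ε)
                + Real.exp (-(α * (2 - x)) / ε)))
              * (Real.exp (-(α * x) / ε)) ^ 2) ≤ 2 / α := by
  have hi : 1 ≤ 1 / ε := by rw [le_div_iff₀ hε]; linarith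
  have e2 : ∀ x, (Real.exp (-(α * x) / ε)) ^ 2 = Real.exp (-((2 * α / ε) * x)) := by
    intro x
    rw [← Real.exp_nat_mul]; congr 1; push_cast; ring
  have e3 : ∀ x, Real.exp (-(α * x) / ε) * (Real.exp (-(α * x) / ε)) ^ 2
      = Real.exp (-((3 * α / ε) * x)) := by
    intro x
    rw [e2, ← Real.exp_add]; congr 1; ring
  have ci : IntervalIntegrable (fun x : ℝ =>
      (1 + 1 / ε * (Real.exp (-(α * x) / ε) + Real.exp (-(α * |x - 1|) / ε)
                + Real.exp (-(α * (2 - x)) / ε)))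
              * (Real.exp (-(α * x) / ε)) ^ 2) MeasureTheory.volume 0 2 :=
    Continuous.intervalIntegrable (by fun_prop) _ _
  constructor
  · have := intervalIntegral.integral_mono_on (μ := MeasureTheory.volume) (a := (0:ℝ)) (b := 2)
      (f := fun x => 1 / ε * Real.exp (-((3 * α / ε) * x))) (by norm_num)
      (Continuous.intervalIntegrable (by fun_prop) _ _) ci (by
        intro x _
        rw [← e3, ← mul_assoc]
        apply mul_le_mul_of_nonneg_right _ (by positivity)
        have h1 := Real.exp_pos (-(α * |x - 1|) / ε)
        have h2 := Real.exp_pos (-(α * (2 - x)) / ε)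
        have h3 : 0 ≤ 1 / ε * (Real.exp (-(α * |x - 1|) / ε) + Real.exp (-(α * (2 - x)) / ε)) := by
          positivity
        linarith)
    refine le_trans ?_ this
    rw [intervalIntegral.integral_const_mul, aux_int _ (by positivity)]
    have h4 : Real.exp (-(3 * α / ε * 2)) ≤ Real.exp (-(6 * α)) := by
      apply Real.exp_le_exp.2
      have : 3 * α / ε * 2 = 6 * α * (1 / ε) := by ring
      rw [this]
      nlinarith
    have h5 : 1 / ε * ((1 - Real.exp (-(3 * α / ε * 2))) / (3 * α / ε))
        = (1 - Real.exp (-(3 * α / ε * 2))) / (3 * α) := by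
      field_simp
    rw [h5]
    gcongr
  · have := intervalIntegral.integral_mono_on (μ := MeasureTheory.volume) (a := (0:ℝ)) (b := 2)
      (g := fun x => 4 / ε * Real.exp (-((2 * α / ε) * x))) (by norm_num) ci
      (Continuous.intervalIntegrable (by fun_prop) _ _) (by
        intro x hx
        rw [← e2]
        apply mul_le_mul_of_nonneg_right _ (by positivity)
        have hle : ∀ t : ℝ, 0 ≤ t → Real.exp (-(α * t) / ε) ≤ 1 := by
          intro t ht
          apply Real.exp_le_one_iff.2
          apply div_nonpos_of_nonpos_of_nonneg _ hε.le
          nlinarith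
        have h1 := hle x hx.1
        have h2 := hle _ (abs_nonneg (x - 1))
        have h3 := hle (2 - x) (by linarith [hx.2])
        have h4 : (4:ℝ) / ε = 1 / ε + 1 / ε * 3 := by ring
        rw [h4]
        have : 0 ≤ 1 / ε := by positivity
        apply add_le_add hi
        apply mul_le_mul_of_nonneg_left _ this
        linarith)
    refine le_trans this ?_
    rw [intervalIntegral.integral_const_mul, aux_int _ (by positivity)]
    have h5 : 4 / ε * ((1 - Real.exp (-(2 * α / ε * 2))) / (2 * α / ε))
        = 2 * (1 - Real.exp (-(2 * α / ε * 2))) / α := by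
      field_simp; norm_num
    rw [h5]
    gcongr
    have := Real.exp_pos (-(2 * α / ε * 2))
    linarith

theorem aux_deriv (α ε : ℝ) (hε : 0 < ε) :
    ε ^ 2 * (∫ x in (0:ℝ)..2,
              (1 + 1 / ε * (Real.exp (-(α * x) / ε) + Real.exp (-(α * |x - 1|) / ε)
                + Real.exp (-(α * (2 - x)) / ε)))
              * (deriv (fun y => Real.exp (-(α * y) / ε)) x) ^ 2) = 
    α ^ 2 * (∫ x in (0:ℝ)..2,
              (1 + 1 / ε * (Real.exp (-(α * x) / ε) + Real.exp (-(α * |x - 1|) / ε)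
                + Real.exp (-(α * (2 - x)) / ε)))
              * (Real.exp (-(α * x) / ε)) ^ 2) := by
  rw [← intervalIntegral.integral_const_mul, ← intervalIntegral.integral_const_mul]
  congr 1
  funext x
  have h1 : HasDerivAt (fun y : ℝ => -(α * y) / ε) (-(α * 1) / ε) x :=
      (((hasDerivAt_id x).const_mul α).neg).div_const ε
  rw [h1.exp.deriv]
  field_simp

/-- The weighted norm with the balanced weight is balanced for boundary layer functions
(Remark 2.1): two-sided `ε`-uniform bounds, with explicit lower constant `(α/3)(1 - e^{-6α})`. -/
theorem balanced_norm_boundary_layer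
    (α γ : ℝ) (hα : 0 < α) (hγ : 0 < γ) :
    (∃ c C : ℝ, 0 < c ∧ 0 < C ∧ ∀ ε ∈ Set.Ioc (0:ℝ) 1,
      c ≤ ε ^ 2 * (∫ x in (0:ℝ)..2,
              (1 + 1 / ε * (Real.exp (-(α * x) / ε) + Real.exp (-(α * |x - 1|) / ε)
                + Real.exp (-(α * (2 - x)) / ε)))
              * (deriv (fun y => Real.exp (-(α * y) / ε)) x) ^ 2)
            + γ * (∫ x in (0:ℝ)..2,
              (1 + 1 / ε * (Real.exp (-(α * x) / ε) + Real.exp (-(α * |x - 1|) / ε)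
                + Real.exp (-(α * (2 - x)) / ε)))
              * (Real.exp (-(α * x) / ε)) ^ 2) ∧
      ε ^ 2 * (∫ x in (0:ℝ)..2,
              (1 + 1 / ε * (Real.exp (-(α * x) / ε) + Real.exp (-(α * |x - 1|) / ε)
                + Real.exp (-(α * (2 - x)) / ε)))
              * (deriv (fun y => Real.exp (-(α * y) / ε)) x) ^ 2)
            + γ * (∫ x in (0:ℝ)..2,
              (1 + 1 / ε * (Real.exp (-(α * x) / ε) + Real.exp (-(α * |x - 1|) / ε)
                + Real.exp (-(α * (2 - x)) / ε)))
              * (Real.exp (-(α * x) / ε)) ^ 2) ≤ C) ∧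
    (∀ ε ∈ Set.Ioc (0:ℝ) 1,
      α / 3 * (1 - Real.exp (-(6 * α)))
        ≤ ε ^ 2 * (∫ x in (0:ℝ)..2,
              (1 + 1 / ε * (Real.exp (-(α * x) / ε) + Real.exp (-(α * |x - 1|) / ε)
                + Real.exp (-(α * (2 - x)) / ε)))
              * (deriv (fun y => Real.exp (-(α * y) / ε)) x) ^ 2)
            + γ * (∫ x in (0:ℝ)..2,
              (1 + 1 / ε * (Real.exp (-(α * x) / ε) + Real.exp (-(α * |x - 1|) / ε)
                + Real.exp (-(α * (2 - x)) / ε)))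
              * (Real.exp (-(α * x) / ε)) ^ 2)) := by
  have key : ∀ ε ∈ Set.Ioc (0:ℝ) 1, _ := fun ε hε => aux_bounds α ε hα hε.1 hε.2
  have hlow : ∀ J : ℝ, (1 - Real.exp (-(6 * α))) / (3 * α) ≤ J →
      α / 3 * (1 - Real.exp (-(6 * α))) ≤ α ^ 2 * J + γ * J := by
    intro J hJ
    have hp : 0 < 1 - Real.exp (-(6 * α)) := by
      have : Real.exp (-(6 * α)) < 1 := Real.exp_lt_one_iff.2 (by linarith)
      linarith
    have hJ0 : 0 ≤ J := le_trans (by positivity) hJ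
    have h1 : α / 3 * (1 - Real.exp (-(6 * α)))
        = α ^ 2 * ((1 - Real.exp (-(6 * α))) / (3 * α)) := by
      field_simp
    rw [h1]
    have h2 := mul_le_mul_of_nonneg_left hJ (sq_nonneg α)
    have h3 : 0 ≤ γ * J := by positivity
    linarith
  refine ⟨⟨α / 3 * (1 - Real.exp (-(6 * α))), (α ^ 2 + γ) * (2 / α), ?_, by positivity, ?_⟩, ?_⟩
  · have : Real.exp (-(6 * α)) < 1 := Real.exp_lt_one_iff.2 (by linarith)
    have : 0 < 1 - Real.exp (-(6 * α)) := by linarith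
    positivity
  · intro ε hε
    rw [aux_deriv α ε hε.1]
    refine ⟨hlow _ (key ε hε).1, ?_⟩
    rw [← add_mul]
    exact mul_le_mul_of_nonneg_left (key ε hε).2 (by positivity)
  · intro ε hε
    rw [aux_deriv α ε hε.1]
    exact hlow _ (key ε hε).1
end

section
/- Quasi-optimality of the weighted Galerkin method (equation (2.16)): suppose β : [0,2] → ℝ is differentiable with β(x) ≥ 1, |β′(x)| ≤ (α/ε)β(x) for all x ∈ [0,2], and β(x) ≤ β(x−1) for all x ∈ (1,2). Let u, u_h, Iu : [0,2] → ℝ be continuously differentiable functions vanishing at 0 and 2, and assume the Galerkin-orthogonality instance B_β(u − u_h, u_h − Iu) = 0. Then there exists a constant C > 0 depending only on α, γ, sup|a| and sup|b| (and not on ε, u, u_h, Iu) such that ⦀u − u_h⦀_β ≤ C·⦀u − Iu⦀_β, where ⦀v⦀_β² := ε²∫₀² β(x)v′(x)² dx + γ∫₀² β(x)v(x)² dx. -/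
open Real Set

lemma aux_young (p t y A B k : ℝ) (hB : 0 ≤ B) (ht : |t| ≤ A * B) (hk : 0 < k) :
    p * t * y ≤ B * (k * p ^ 2 + A ^ 2 * y ^ 2 / (4 * k)) := by
  have h1 : p * t * y ≤ |p| * (A * B) * |y| := by
    calc p * t * y ≤ |p * t * y| := le_abs_self _
      _ = |p| * |t| * |y| := by rw [abs_mul, abs_mul]
      _ ≤ _ := by gcongr
  have h2 : A * |p| * |y| ≤ k * p ^ 2 + A ^ 2 * y ^ 2 / (4 * k) := by
    have : k * p ^ 2 + A ^ 2 * y ^ 2 / (4 * k) - A * |p| * |y|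
        = (2 * k * |p| - A * |y|) ^ 2 / (4 * k) := by
      rw [← sq_abs p, ← sq_abs y]; field_simp; ring
    have h3 : 0 ≤ (2 * k * |p| - A * |y|) ^ 2 / (4 * k) := by positivity
    linarith
  calc _ ≤ _ := h1
    _ = B * (A * |p| * |y|) := by ring
    _ ≤ _ := by gcongr

lemma aux_F1 (ε α B d e e' n n' : ℝ) (hε : 0 < ε) (hB : 0 ≤ B)
    (hd : |d| ≤ α / ε * B) :
    ε ^ 2 * (e' * (d * (n - e) + B * (n' - e'))) ≤
      -(1/4) * ε ^ 2 * (B * e' ^ 2) + 1/2 * α ^ 2 * (B * e ^ 2) + 2 * ε ^ 2 * (B * n' ^ 2)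
        + 2 * α ^ 2 * (B * n ^ 2) := by
  have ht : |ε * d| ≤ α * B := by
    rw [abs_mul, abs_of_pos hε]
    calc ε * |d| ≤ ε * (α / ε * B) := by gcongr
      _ = α * B := by field_simp
  have h1 := aux_young (ε * e') (ε * d) n α B (1/8) hB ht (by norm_num)
  have h2 := aux_young (ε * e') (ε * d) (-e) α B (1/2) hB ht (by norm_num)
  have h3 := aux_young (ε * e') B (ε * n') 1 B (1/8) hB (by rw [abs_of_nonneg hB, one_mul])
    (by norm_num)
  ring_nf at h1 h2 h3 ⊢
  linarith

lemma aux_F2 (A a α γ B e n : ℝ) (hγ : 0 < γ) (hB : 0 ≤ B) (ha : α ^ 2 ≤ a) (haA : a ≤ A) :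
    a * e * (n - e) * B ≤ -(α ^ 2 - γ / 8) * (B * e ^ 2) + 2 * A ^ 2 / γ * (B * n ^ 2) := by
  have ha0 : 0 ≤ a := le_trans (sq_nonneg _) ha
  have h1 := aux_young e (a * B) n A B (γ/8) hB
    (by rw [abs_of_nonneg (by positivity)]; gcongr) (by positivity)
  have h2 : α ^ 2 * (B * e ^ 2) ≤ a * (B * e ^ 2) := by gcongr
  have h3 : A ^ 2 * n ^ 2 / (4 * (γ / 8)) = 2 * A ^ 2 / γ * n ^ 2 := by field_simp; ring
  rw [h3] at h1
  linarith

lemma aux_G (S b γ B B' e e' n : ℝ) (hγ : 0 < γ) (hB : 0 ≤ B) (hBB : B ≤ B') (hb : |b| ≤ S) :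
    b * e' * (n - e) * B ≤ (S / 2 + γ / 8) * (B' * e' ^ 2) + S / 2 * (B * e ^ 2)
      + 2 * S ^ 2 / γ * (B * n ^ 2) := by
  have hS : 0 ≤ S := (abs_nonneg _).trans hb
  have hbB : |b * B| ≤ S * B := by rw [abs_mul, abs_of_nonneg hB]; gcongr
  have h1 := aux_young e' (b * B) n S B (γ/8) hB hbB (by positivity)
  have h3 : S ^ 2 * n ^ 2 / (4 * (γ / 8)) = 2 * S ^ 2 / γ * n ^ 2 := by field_simp; ring
  rw [h3] at h1
  have h2 : -(b * B) * (e' * e) ≤ S * B * ((e' ^ 2 + e ^ 2) / 2) := by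
    calc -(b * B) * (e' * e) ≤ |-(b * B) * (e' * e)| := le_abs_self _
      _ = |b * B| * |e' * e| := by rw [abs_mul, abs_neg]
      _ ≤ (S * B) * ((e' ^ 2 + e ^ 2) / 2) := by
        gcongr
        rw [abs_le]; constructor <;> nlinarith [sq_nonneg (e' + e), sq_nonneg (e' - e)]
  have h4 : (S / 2 + γ / 8) * (B * e' ^ 2) ≤ (S / 2 + γ / 8) * (B' * e' ^ 2) := by gcongr
  linarith

/-- Quasi-optimality of the weighted Galerkin method (equation (2.16)):
`⦀u - u_h⦀_β ≤ C ⦀u - Iu⦀_β` with `C` depending only on `α`, `γ`, `sup|a|`, `sup|b|`. -/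
theorem weighted_quasi_optimality
    (α γ : ℝ) (hα : 0 < α) (hγ : 0 < γ)
    (a b : ℝ → ℝ) (ha_cont : ContinuousOn a (Set.Icc 0 2))
    (hb_cont : ContinuousOn b (Set.Icc 0 2))
    (ha : ∀ x ∈ Set.Icc (0:ℝ) 2, α ^ 2 ≤ a x)
    (hb : γ ≤ α ^ 2 - sSup ((fun x => |b x|) '' Set.Icc (0:ℝ) 2)) :
    ∃ C : ℝ, 0 < C ∧
      ∀ ε ∈ Set.Ioc (0:ℝ) 1, ∀ β : ℝ → ℝ, Differentiable ℝ β →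
        (∀ x ∈ Set.Icc (0:ℝ) 2, 1 ≤ β x) →
        (∀ x ∈ Set.Icc (0:ℝ) 2, |deriv β x| ≤ α / ε * β x) →
        (∀ x ∈ Set.Ioo (1:ℝ) 2, β x ≤ β (x - 1)) →
        ∀ u uh Iu : ℝ → ℝ,
          ContDiff ℝ 1 u → ContDiff ℝ 1 uh → ContDiff ℝ 1 Iu →
          u 0 = 0 → u 2 = 0 → uh 0 = 0 → uh 2 = 0 → Iu 0 = 0 → Iu 2 = 0 →
          -- Galerkin orthogonality instance `B_β(u - u_h, u_h - Iu) = 0`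
          (ε ^ 2 * (∫ x in (0:ℝ)..2,
                deriv (fun y => u y - uh y) x * deriv (fun y => β y * (uh y - Iu y)) x)
            + (∫ x in (0:ℝ)..2, a x * (u x - uh x) * (uh x - Iu x) * β x)
            + (∫ x in (1:ℝ)..2, b x * (u (x - 1) - uh (x - 1)) * (uh x - Iu x) * β x) = 0) →
          Real.sqrt (ε ^ 2 * (∫ x in (0:ℝ)..2, β x * (deriv (fun y => u y - uh y) x) ^ 2)
              + γ * (∫ x in (0:ℝ)..2, β x * (u x - uh x) ^ 2))
            ≤ C * Real.sqrt (ε ^ 2 * (∫ x in (0:ℝ)..2, β x * (deriv (fun y => u y - Iu y) x) ^ 2)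
              + γ * (∫ x in (0:ℝ)..2, β x * (u x - Iu x) ^ 2)) := by
  have hbbd : BddAbove ((fun x => |b x|) '' Set.Icc (0:ℝ) 2) :=
    (isCompact_Icc.image_of_continuousOn hb_cont.abs).bddAbove
  obtain ⟨A, hA⟩ := (isCompact_Icc.image_of_continuousOn ha_cont).bddAbove
  have hA' : ∀ x ∈ Set.Icc (0:ℝ) 2, a x ≤ A := fun x hx => hA ⟨x, hx, rfl⟩
  set S := sSup ((fun x => |b x|) '' Set.Icc (0:ℝ) 2) with hS
  have hbS : ∀ x ∈ Set.Icc (0:ℝ) 2, |b x| ≤ S := fun x hx => le_csSup hbbd ⟨x, hx, rfl⟩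
  have hS0 : 0 ≤ S := (abs_nonneg _).trans (hbS 0 ⟨le_rfl, by norm_num⟩)
  clear_value S
  set M := 2 * α ^ 2 + 2 * A ^ 2 / γ + 2 * S ^ 2 / γ with hM
  have hM0 : 0 ≤ M := by positivity
  refine ⟨Real.sqrt (8 + 4 * M / γ), by positivity, ?_⟩
  intro ε hε β hβ hβ1 hβ' hβm u uh Iu hu huh hIu _ _ _ _ _ _ horth
  have hε0 : 0 < ε := hε.1
  obtain ⟨e, he⟩ : ∃ e : ℝ → ℝ, e = fun y => u y - uh y := ⟨_, rfl⟩
  obtain ⟨n, hn⟩ : ∃ n : ℝ → ℝ, n = fun y => u y - Iu y := ⟨_, rfl⟩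
  have hex : ∀ y, u y - uh y = e y := fun y => by rw [he]
  have hnx : ∀ y, u y - Iu y = n y := fun y => by rw [hn]
  have hcx : ∀ y, uh y - Iu y = n y - e y := fun y => by rw [he, hn]; ring
  have heC : ContDiff ℝ 1 e := he ▸ hu.sub huh
  have hnC : ContDiff ℝ 1 n := hn ▸ hu.sub hIu
  simp only [hex, hnx, hcx] at horth ⊢
  have hed : Differentiable ℝ e := heC.differentiable (by norm_num)
  have hnd : Differentiable ℝ n := hnC.differentiable (by norm_num)
  have hec : Continuous e := heC.continuous
  have hnc : Continuous n := hnC.continuous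
  have hec' : Continuous (deriv e) := heC.continuous_deriv (by norm_num)
  have hnc' : Continuous (deriv n) := hnC.continuous_deriv (by norm_num)
  have hβc : Continuous β := hβ.continuous
  have hβ0 : ∀ x ∈ Set.Icc (0:ℝ) 2, 0 ≤ β x := fun x hx => zero_le_one.trans (hβ1 x hx)
  have hder : ∀ x, deriv (fun y => β y * (n y - e y)) x
      = deriv β x * (n x - e x) + β x * (deriv n x - deriv e x) := by
    intro x
    exact ((hβ x).hasDerivAt.mul ((hnd x).hasDerivAt.sub (hed x).hasDerivAt)).deriv
  simp only [hder] at horth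
  have hβi : IntervalIntegrable (deriv β) MeasureTheory.volume 0 2 := by
    have hc : IntervalIntegrable (fun x => α / ε * β x) MeasureTheory.volume 0 2 :=
      (continuous_const.mul hβc).intervalIntegrable _ _
    refine hc.mono_fun' (measurable_deriv β).aestronglyMeasurable ?_
    rw [Set.uIoc_of_le (by norm_num)]
    filter_upwards [MeasureTheory.ae_restrict_mem measurableSet_Ioc] with x hx
    exact hβ' x ⟨hx.1.le, hx.2⟩
  have I1 : IntervalIntegrable (fun x => ε ^ 2 * (deriv e x * (deriv β x * (n x - e x)
      + β x * (deriv n x - deriv e x)))) MeasureTheory.volume 0 2 := by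
    have h1 : IntervalIntegrable (fun x => deriv β x * (n x - e x)) MeasureTheory.volume 0 2 :=
      hβi.mul_continuousOn (by fun_prop)
    have h2 : IntervalIntegrable (fun x => β x * (deriv n x - deriv e x))
        MeasureTheory.volume 0 2 := Continuous.intervalIntegrable (by fun_prop) _ _
    exact ((h1.add h2).continuousOn_mul hec'.continuousOn).const_mul _
  have I2 : IntervalIntegrable (fun x => a x * e x * (n x - e x) * β x)
      MeasureTheory.volume 0 2 := by
    apply ContinuousOn.intervalIntegrable
    rw [Set.uIcc_of_le (by norm_num)]
    fun_prop
  have I3 : IntervalIntegrable (fun x => b x * e (x - 1) * (n x - e x) * β x)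
      MeasureTheory.volume 1 2 := by
    apply ContinuousOn.intervalIntegrable
    rw [Set.uIcc_of_le (by norm_num)]
    have : ContinuousOn b (Set.Icc 1 2) := hb_cont.mono (Set.Icc_subset_Icc_left (by norm_num))
    fun_prop
  have cQ1 : Continuous (fun x => β x * deriv e x ^ 2) := by fun_prop
  have cQ0 : Continuous (fun x => β x * e x ^ 2) := by fun_prop
  have cR1 : Continuous (fun x => β x * deriv n x ^ 2) := by fun_prop
  have cR0 : Continuous (fun x => β x * n x ^ 2) := by fun_prop
  have cQs : Continuous (fun x => β (x - 1) * e (x - 1) ^ 2) := by fun_prop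
  have ci : ∀ (k : ℝ) (f : ℝ → ℝ), Continuous f → ∀ s t : ℝ,
      IntervalIntegrable (fun x => k * f x) MeasureTheory.volume s t :=
    fun k f hf s t => (continuous_const.mul hf).intervalIntegrable s t
  have B1 := intervalIntegral.integral_mono_on (by norm_num) I1
    ((((ci (-(1/4) * ε ^ 2) _ cQ1 0 2).add (ci (1/2 * α ^ 2) _ cQ0 0 2)).add
      (ci (2 * ε ^ 2) _ cR1 0 2)).add (ci (2 * α ^ 2) _ cR0 0 2))
    (fun x hx => aux_F1 ε α (β x) (deriv β x) (e x) (deriv e x) (n x) (deriv n x) hε0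
      (hβ0 x hx) (hβ' x hx))
  have B2 := intervalIntegral.integral_mono_on (by norm_num) I2
    ((ci (-(α ^ 2 - γ / 8)) _ cQ0 0 2).add (ci (2 * A ^ 2 / γ) _ cR0 0 2))
    (fun x hx => aux_F2 A (a x) α γ (β x) (e x) (n x) hγ (hβ0 x hx) (ha x hx) (hA' x hx))
  have B3 := intervalIntegral.integral_mono_on_of_le_Ioo (by norm_num) I3
    (((ci (S / 2 + γ / 8) _ cQs 1 2).add (ci (S / 2) _ cQ0 1 2)).add
      (ci (2 * S ^ 2 / γ) _ cR0 1 2))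
    (fun x hx => by
      have hx' : x ∈ Set.Icc (0:ℝ) 2 := ⟨by linarith [hx.1], hx.2.le⟩
      exact aux_G S (b x) γ (β x) (β (x - 1)) (e x) (e (x - 1)) (n x) hγ (hβ0 x hx')
        (hβm x hx) (hbS x hx'))
  rw [intervalIntegral.integral_add (((ci _ _ cQ1 0 2).add (ci _ _ cQ0 0 2)).add
      (ci _ _ cR1 0 2)) (ci _ _ cR0 0 2),
    intervalIntegral.integral_add ((ci _ _ cQ1 0 2).add (ci _ _ cQ0 0 2)) (ci _ _ cR1 0 2),
    intervalIntegral.integral_add (ci _ _ cQ1 0 2) (ci _ _ cQ0 0 2)] at B1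
  rw [intervalIntegral.integral_add (ci _ _ cQ0 0 2) (ci _ _ cR0 0 2)] at B2
  rw [intervalIntegral.integral_add ((ci _ _ cQs 1 2).add (ci _ _ cQ0 1 2)) (ci _ _ cR0 1 2),
    intervalIntegral.integral_add (ci _ _ cQs 1 2) (ci _ _ cQ0 1 2)] at B3
  simp only [intervalIntegral.integral_const_mul] at B1 B2 B3
  have hshift : ∫ x in (1:ℝ)..2, β (x - 1) * e (x - 1) ^ 2 = ∫ x in (0:ℝ)..1, β x * e x ^ 2 := by
    rw [intervalIntegral.integral_comp_sub_right (fun x => β x * e x ^ 2) 1]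
    norm_num
  rw [hshift] at B3
  have sQ := intervalIntegral.integral_add_adjacent_intervals
    (cQ0.intervalIntegrable (μ := MeasureTheory.volume) 0 1) (cQ0.intervalIntegrable 1 2)
  have sR := intervalIntegral.integral_add_adjacent_intervals
    (cR0.intervalIntegrable (μ := MeasureTheory.volume) 0 1) (cR0.intervalIntegrable 1 2)
  have pQ : 0 ≤ ∫ x in (1:ℝ)..2, β x * e x ^ 2 :=
    intervalIntegral.integral_nonneg (by norm_num) (fun x hx =>
      mul_nonneg (hβ0 x ⟨by linarith [hx.1], hx.2⟩) (sq_nonneg _))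
  have pQ2 : 0 ≤ ∫ x in (0:ℝ)..2, β x * e x ^ 2 :=
    intervalIntegral.integral_nonneg (by norm_num) (fun x hx =>
      mul_nonneg (hβ0 x hx) (sq_nonneg _))
  have pR : 0 ≤ ∫ x in (0:ℝ)..1, β x * n x ^ 2 :=
    intervalIntegral.integral_nonneg (by norm_num) (fun x hx =>
      mul_nonneg (hβ0 x ⟨hx.1, by linarith [hx.2]⟩) (sq_nonneg _))
  have pR2 : 0 ≤ ∫ x in (0:ℝ)..2, β x * n x ^ 2 :=
    intervalIntegral.integral_nonneg (by norm_num) (fun x hx =>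
      mul_nonneg (hβ0 x hx) (sq_nonneg _))
  have pR1 : 0 ≤ ∫ x in (0:ℝ)..2, β x * deriv n x ^ 2 :=
    intervalIntegral.integral_nonneg (by norm_num) (fun x hx =>
      mul_nonneg (hβ0 x hx) (sq_nonneg _))
  rw [← Real.sqrt_mul (by positivity)]
  apply Real.sqrt_le_sqrt
  generalize (∫ x in (0:ℝ)..2, β x * deriv e x ^ 2) = Q1 at *
  generalize (∫ x in (0:ℝ)..2, β x * e x ^ 2) = Q0 at *
  generalize (∫ x in (0:ℝ)..1, β x * e x ^ 2) = Qa at *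
  generalize (∫ x in (1:ℝ)..2, β x * e x ^ 2) = Qb at *
  generalize (∫ x in (0:ℝ)..2, β x * deriv n x ^ 2) = R1 at *
  generalize (∫ x in (0:ℝ)..2, β x * n x ^ 2) = R0 at *
  generalize (∫ x in (0:ℝ)..1, β x * n x ^ 2) = Ra at *
  generalize (∫ x in (1:ℝ)..2, β x * n x ^ 2) = Rb at *
  have e1 : 2 * S ^ 2 / γ * Rb ≤ 2 * S ^ 2 / γ * R0 := by gcongr; linarith
  have e2 : γ / 8 * Qa ≤ γ / 8 * Q0 := by gcongr; linarith
  have e3 : (γ + S) * Q0 ≤ α ^ 2 * Q0 := by gcongr; linarith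
  have e4 : S / 2 * Qa + S / 2 * Qb = S / 2 * Q0 := by rw [← sQ]; ring
  have key : 1 / 4 * (ε ^ 2 * Q1) + 1 / 4 * (γ * Q0) ≤ 2 * (ε ^ 2 * R1) + M * R0 := by
    rw [hM]
    linarith
  have e5 : (8 + 4 * M / γ) * (ε ^ 2 * R1 + γ * R0) = 8 * (ε ^ 2 * R1) + 4 * (M * R0)
      + (4 * M / γ * (ε ^ 2 * R1) + 8 * (γ * R0)) := by
    field_simp; ring
  have e6 : 0 ≤ 4 * M / γ * (ε ^ 2 * R1) + 8 * (γ * R0) := by positivity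
  rw [e5]
  linarith
end

section
/- Continuity bound for the weighted bilinear form (equation (2.15)): suppose β : [0,2] → ℝ is differentiable with β(x) ≥ 1, |β′(x)| ≤ (α/ε)β(x) for all x ∈ [0,2], and β(x) ≤ β(x−1) for all x ∈ (1,2). Then for all continuously differentiable η, ξ : [0,2] → ℝ with ξ(0) = ξ(2) = 0 one has |B_β(η,ξ)| ≤ ε²‖η′‖_β‖ξ′‖_β + εα‖η′‖_β‖ξ‖_β + (sup|a|)‖η‖_β‖ξ‖_β + (sup|b|)‖η‖_β‖ξ‖_β, where ‖v‖_β² := ∫₀² v(x)²β(x) dx. -/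
open Real Set

theorem cs_aux (p q : ℝ) (hpq : p ≤ q) (f g w : ℝ → ℝ) (hf : Continuous f) (hg : Continuous g)
    (hw : Continuous w) (hw0 : ∀ x ∈ Set.Icc p q, 0 ≤ w x) :
    ∫ x in p..q, |f x| * |g x| * w x ≤
      Real.sqrt (∫ x in p..q, (f x) ^ 2 * w x) * Real.sqrt (∫ x in p..q, (g x) ^ 2 * w x) := by
  have hA : 0 ≤ ∫ x in p..q, (f x) ^ 2 * w x :=
    intervalIntegral.integral_nonneg hpq fun x hx => mul_nonneg (sq_nonneg _) (hw0 x hx)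
  rw [← Real.sqrt_mul hA]
  apply Real.le_sqrt_of_sq_le
  have key : ∀ t : ℝ, 0 ≤ (∫ x in p..q, (g x) ^ 2 * w x) * (t * t)
      + (-2 * ∫ x in p..q, |f x| * |g x| * w x) * t + ∫ x in p..q, (f x) ^ 2 * w x := by
    intro t
    have h0 : 0 ≤ ∫ x in p..q, (|f x| - t * |g x|) ^ 2 * w x :=
      intervalIntegral.integral_nonneg hpq fun x hx => mul_nonneg (sq_nonneg _) (hw0 x hx)
    have h1 : ∫ x in p..q, (|f x| - t * |g x|) ^ 2 * w x
        = ∫ x in p..q, ((t * t) * ((g x) ^ 2 * w x) + (-2 * t) * (|f x| * |g x| * w x)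
          + (f x) ^ 2 * w x) := by
      congr 1
      ext x
      rw [← sq_abs (f x), ← sq_abs (g x)]
      ring
    rw [h1, intervalIntegral.integral_add, intervalIntegral.integral_add,
      intervalIntegral.integral_const_mul, intervalIntegral.integral_const_mul] at h0
    · linarith
    all_goals
      apply Continuous.intervalIntegrable
      fun_prop
  have := discrim_le_zero key
  unfold discrim at this
  nlinarith

/-- Continuity bound for the weighted bilinear form (equation (2.15)). -/
theorem weighted_continuity_bound
    (ε α : ℝ) (hε : ε ∈ Set.Ioc (0:ℝ) 1) (hα : 0 < α)
    (a b : ℝ → ℝ) (ha_cont : ContinuousOn a (Set.Icc 0 2))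
    (hb_cont : ContinuousOn b (Set.Icc 0 2))
    (β : ℝ → ℝ) (hβ_diff : Differentiable ℝ β)
    (hβ1 : ∀ x ∈ Set.Icc (0:ℝ) 2, 1 ≤ β x)
    (hβ' : ∀ x ∈ Set.Icc (0:ℝ) 2, |deriv β x| ≤ α / ε * β x)
    (hβ_shift : ∀ x ∈ Set.Ioo (1:ℝ) 2, β x ≤ β (x - 1))
    (η ξ : ℝ → ℝ) (hη : ContDiff ℝ 1 η) (hξ : ContDiff ℝ 1 ξ)
    (hξ0 : ξ 0 = 0) (hξ2 : ξ 2 = 0) :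
    |ε ^ 2 * (∫ x in (0:ℝ)..2, deriv η x * deriv (fun y => β y * ξ y) x)
        + (∫ x in (0:ℝ)..2, a x * η x * ξ x * β x)
        + (∫ x in (1:ℝ)..2, b x * η (x - 1) * ξ x * β x)|
      ≤ ε ^ 2 * Real.sqrt (∫ x in (0:ℝ)..2, (deriv η x) ^ 2 * β x)
            * Real.sqrt (∫ x in (0:ℝ)..2, (deriv ξ x) ^ 2 * β x)
        + ε * α * Real.sqrt (∫ x in (0:ℝ)..2, (deriv η x) ^ 2 * β x)
            * Real.sqrt (∫ x in (0:ℝ)..2, (ξ x) ^ 2 * β x)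
        + sSup ((fun x => |a x|) '' Set.Icc (0:ℝ) 2)
            * Real.sqrt (∫ x in (0:ℝ)..2, (η x) ^ 2 * β x)
            * Real.sqrt (∫ x in (0:ℝ)..2, (ξ x) ^ 2 * β x)
        + sSup ((fun x => |b x|) '' Set.Icc (0:ℝ) 2)
            * Real.sqrt (∫ x in (0:ℝ)..2, (η x) ^ 2 * β x)
            * Real.sqrt (∫ x in (0:ℝ)..2, (ξ x) ^ 2 * β x) := by
  obtain ⟨he0, he1⟩ := hε
  have hβc : Continuous β := hβ_diff.continuous
  have hηc : Continuous η := hη.continuous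
  have hξc : Continuous ξ := hξ.continuous
  have hη'c : Continuous (deriv η) := hη.continuous_deriv le_rfl
  have hξ'c : Continuous (deriv ξ) := hξ.continuous_deriv le_rfl
  have hβ0 : ∀ x ∈ Set.Icc (0:ℝ) 2, 0 ≤ β x := fun x hx => zero_le_one.trans (hβ1 x hx)
  have hSle : ∀ c : ℝ → ℝ, ContinuousOn c (Set.Icc 0 2) → ∀ x ∈ Set.Icc (0:ℝ) 2,
      |c x| ≤ sSup ((fun x => |c x|) '' Set.Icc (0:ℝ) 2) := by
    intro c hc x hx
    exact le_csSup (isCompact_Icc.image_of_continuousOn hc.abs).bddAbove ⟨x, hx, rfl⟩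
  have hSa := hSle a ha_cont
  have hSb := hSle b hb_cont
  set Sa := sSup ((fun x => |a x|) '' Set.Icc (0:ℝ) 2)
  set Sb := sSup ((fun x => |b x|) '' Set.Icc (0:ℝ) 2)
  have hSb0 : 0 ≤ Sb := (abs_nonneg _).trans (hSb 0 (by norm_num))
  have hSa0 : 0 ≤ Sa := (abs_nonneg _).trans (hSa 0 (by norm_num))
  have c1 := cs_aux 0 2 (by norm_num) (deriv η) (deriv ξ) β hη'c hξ'c hβc hβ0
  have c2 := cs_aux 0 2 (by norm_num) (deriv η) ξ β hη'c hξc hβc hβ0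
  have c3 := cs_aux 0 2 (by norm_num) η ξ β hηc hξc hβc hβ0
  have c4 := cs_aux 1 2 (by norm_num) (fun x => η (x - 1)) ξ β (by fun_prop) hξc hβc
    (fun x hx => hβ0 x ⟨by linarith [hx.1], hx.2⟩)
  have t1 : |∫ x in (0:ℝ)..2, deriv η x * deriv (fun y => β y * ξ y) x| ≤
      (∫ x in (0:ℝ)..2, |deriv η x| * |deriv ξ x| * β x)
        + α / ε * ∫ x in (0:ℝ)..2, |deriv η x| * |ξ x| * β x := by
    rw [← intervalIntegral.integral_const_mul, ← intervalIntegral.integral_add,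
      ← Real.norm_eq_abs]
    · apply intervalIntegral.norm_integral_le_of_norm_le (by norm_num)
      · refine Filter.Eventually.of_forall fun x hx => ?_
        have hx' : x ∈ Set.Icc (0:ℝ) 2 := ⟨hx.1.le, hx.2⟩
        have hd : deriv (fun y => β y * ξ y) x = deriv β x * ξ x + β x * deriv ξ x :=
          deriv_fun_mul (hβ_diff x) (hξ.differentiable (by norm_num) x)
        rw [hd, Real.norm_eq_abs, abs_mul]
        have h1 : |deriv β x * ξ x + β x * deriv ξ x| ≤
            α / ε * β x * |ξ x| + β x * |deriv ξ x| := by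
          refine (abs_add_le _ _).trans ?_
          rw [abs_mul, abs_mul, abs_of_nonneg (hβ0 x hx')]
          gcongr
          exact hβ' x hx'
        calc _ ≤ |deriv η x| * (α / ε * β x * |ξ x| + β x * |deriv ξ x|) := by gcongr
          _ = _ := by ring
      · apply Continuous.intervalIntegrable
        fun_prop
    all_goals
      apply Continuous.intervalIntegrable
      fun_prop
  have t2 : |∫ x in (0:ℝ)..2, a x * η x * ξ x * β x| ≤
      Sa * ∫ x in (0:ℝ)..2, |η x| * |ξ x| * β x := by
    rw [← intervalIntegral.integral_const_mul, ← Real.norm_eq_abs]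
    apply intervalIntegral.norm_integral_le_of_norm_le (by norm_num)
    · refine Filter.Eventually.of_forall fun x hx => ?_
      have hx' : x ∈ Set.Icc (0:ℝ) 2 := ⟨hx.1.le, hx.2⟩
      have h0 := hβ0 x hx'
      rw [Real.norm_eq_abs, abs_mul, abs_mul, abs_mul, abs_of_nonneg h0]
      calc _ = |a x| * (|η x| * |ξ x| * β x) := by ring
        _ ≤ _ := by
          gcongr
          exact hSa x hx'
    · apply Continuous.intervalIntegrable
      fun_prop
  have t3 : |∫ x in (1:ℝ)..2, b x * η (x - 1) * ξ x * β x| ≤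
      Sb * ∫ x in (1:ℝ)..2, |η (x - 1)| * |ξ x| * β x := by
    rw [← intervalIntegral.integral_const_mul, ← Real.norm_eq_abs]
    apply intervalIntegral.norm_integral_le_of_norm_le (by norm_num)
    · refine Filter.Eventually.of_forall fun x hx => ?_
      have hx' : x ∈ Set.Icc (0:ℝ) 2 := ⟨by linarith [hx.1], hx.2⟩
      have h0 := hβ0 x hx'
      rw [Real.norm_eq_abs, abs_mul, abs_mul, abs_mul, abs_of_nonneg h0]
      calc _ = |b x| * (|η (x - 1)| * |ξ x| * β x) := by ring
        _ ≤ _ := by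
          gcongr
          exact hSb x hx'
    · apply Continuous.intervalIntegrable
      fun_prop
  have ii : ∀ (f : ℝ → ℝ), Continuous f → ∀ p q : ℝ,
      IntervalIntegrable (fun x => (f x) ^ 2 * β x) MeasureTheory.volume p q := by
    intro f hf p q
    apply Continuous.intervalIntegrable
    fun_prop
  have m1 : ∫ x in (1:ℝ)..2, (ξ x) ^ 2 * β x ≤ ∫ x in (0:ℝ)..2, (ξ x) ^ 2 * β x := by
    rw [← intervalIntegral.integral_add_adjacent_intervals (ii ξ hξc 0 1) (ii ξ hξc 1 2)]
    have : 0 ≤ ∫ x in (0:ℝ)..1, (ξ x) ^ 2 * β x :=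
      intervalIntegral.integral_nonneg (by norm_num) fun x hx =>
        mul_nonneg (sq_nonneg _) (hβ0 x ⟨hx.1, by linarith [hx.2]⟩)
    linarith
  have m2 : ∫ x in (1:ℝ)..2, (η (x - 1)) ^ 2 * β x ≤ ∫ x in (0:ℝ)..2, (η x) ^ 2 * β x := by
    have h1 : ∫ x in (1:ℝ)..2, (η (x - 1)) ^ 2 * β x ≤
        ∫ x in (1:ℝ)..2, (η (x - 1)) ^ 2 * β (x - 1) := by
      apply intervalIntegral.integral_mono_on_of_le_Ioo (by norm_num)
      · exact ii (fun x => η (x - 1)) (by fun_prop) 1 2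
      · apply Continuous.intervalIntegrable
        fun_prop
      · intro x hx
        exact mul_le_mul_of_nonneg_left (hβ_shift x hx) (sq_nonneg _)
    rw [intervalIntegral.integral_comp_sub_right (fun x => (η x) ^ 2 * β x) 1] at h1
    norm_num at h1
    rw [← intervalIntegral.integral_add_adjacent_intervals (ii η hηc 0 1) (ii η hηc 1 2)]
    have : 0 ≤ ∫ x in (1:ℝ)..2, (η x) ^ 2 * β x :=
      intervalIntegral.integral_nonneg (by norm_num) fun x hx =>
        mul_nonneg (sq_nonneg _) (hβ0 x ⟨by linarith [hx.1], hx.2⟩)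
    linarith
  have c5 := c4.trans (mul_le_mul (Real.sqrt_le_sqrt m2) (Real.sqrt_le_sqrt m1)
    (Real.sqrt_nonneg _) (Real.sqrt_nonneg _))
  set N1 := Real.sqrt (∫ x in (0:ℝ)..2, (deriv η x) ^ 2 * β x)
  set N2 := Real.sqrt (∫ x in (0:ℝ)..2, (deriv ξ x) ^ 2 * β x)
  set N3 := Real.sqrt (∫ x in (0:ℝ)..2, (ξ x) ^ 2 * β x)
  set N4 := Real.sqrt (∫ x in (0:ℝ)..2, (η x) ^ 2 * β x)
  have u1 := t1.trans (add_le_add c1 (mul_le_mul_of_nonneg_left c2 (div_pos hα he0).le))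
  have u2 := t2.trans (mul_le_mul_of_nonneg_left c3 hSa0)
  have u3 := t3.trans (mul_le_mul_of_nonneg_left c5 hSb0)
  have u1' := mul_le_mul_of_nonneg_left u1 (sq_nonneg ε)
  have e1 : ε ^ 2 * (N1 * N2 + α / ε * (N1 * N3)) = ε ^ 2 * N1 * N2 + ε * α * N1 * N3 := by
    field_simp
  refine (abs_add_le _ _).trans ?_
  refine (add_le_add_left (abs_add_le _ _) _).trans ?_
  rw [abs_mul, abs_of_nonneg (sq_nonneg ε)]
  linarith
end

section
/- Mesh-parameter bound for the Durán mesh (inequality (2.9)): there exists an absolute constant C > 0 such that for all H ∈ (0,1) and all ε with 0 < ε ≤ min(H, e^{−1}), setting M := ⌈1 − ln(2Hε)/ln(1+H)⌉ and N := 4M, one has H ≤ C·N^{−1}·ln(1/ε). -/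
open Real Set

/-- Mesh-parameter bound for the Durán mesh (inequality (2.9)):
`H ≲ N⁻¹ ln(1/ε)` with `N = 4M` and `M = ⌈1 - ln(2Hε)/ln(1+H)⌉`. -/
theorem duran_mesh_parameter_bound :
    ∃ C : ℝ, 0 < C ∧ ∀ H ∈ Set.Ioo (0:ℝ) 1, ∀ ε : ℝ, 0 < ε →
      ε ≤ min H (Real.exp (-1)) →
      H ≤ C * (((4 * ⌈1 - Real.log (2 * H * ε) / Real.log (1 + H)⌉ : ℤ) : ℝ))⁻¹
            * Real.log (1 / ε) := by
  refine ⟨24, by norm_num, ?_⟩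
  rintro H ⟨h0, h1⟩ ε hε hle
  have hH : ε ≤ H := hle.trans (min_le_left _ _)
  have he : ε ≤ Real.exp (-1) := hle.trans (min_le_right _ _)
  have hlogε : Real.log ε ≤ -1 := by
    have := Real.log_le_log hε he
    rwa [Real.log_exp] at this
  have hlogH : Real.log ε ≤ Real.log H := Real.log_le_log hε hH
  have hlogH0 : Real.log H < 0 := Real.log_neg h0 h1
  have hl2 : Real.log 2 < 1 := by linarith [Real.log_two_lt_d9]
  have hl2p : 0 < Real.log 2 := Real.log_pos (by norm_num)
  have hsplit : Real.log (2 * H * ε) = Real.log 2 + Real.log H + Real.log ε := by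
    rw [Real.log_mul (by positivity) hε.ne', Real.log_mul (by norm_num) h0.ne']
  have hlow : H / 2 ≤ Real.log (1 + H) := by
    have h := Real.one_sub_inv_le_log_of_pos (show 0 < 1 + H by linarith)
    have h2 : H / 2 ≤ 1 - (1 + H)⁻¹ := by
      have h3 : 1 - (1 + H)⁻¹ = H / (1 + H) := by field_simp; ring
      rw [h3]
      exact div_le_div_of_nonneg_left h0.le (by linarith) (by linarith)
    linarith
  have hlp : 0 < Real.log (1 + H) := by linarith
  set q := Real.log (2 * H * ε) / Real.log (1 + H) with hq
  have hqm : q * Real.log (1 + H) = Real.log (2 * H * ε) := div_mul_cancel₀ _ hlp.ne'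
  have hq0 : q < 0 := div_neg_of_neg_of_pos (by linarith) hlp
  have hM1 : 1 - q ≤ (⌈1 - q⌉ : ℝ) := Int.le_ceil _
  have hM2 : (⌈1 - q⌉ : ℝ) < 1 - q + 1 := Int.ceil_lt_add_one _
  have hMp : (0:ℝ) < (⌈1 - q⌉ : ℝ) := by linarith
  have hqH : -q * (H / 2) ≤ -q * Real.log (1 + H) :=
    mul_le_mul_of_nonneg_left hlow (by linarith)
  have hHM : H * (⌈1 - q⌉ : ℝ) ≤ H * (1 - q + 1) :=
    mul_le_mul_of_nonneg_left hM2.le h0.le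
  have hlog : Real.log (1 / ε) = - Real.log ε := by rw [one_div, Real.log_inv]
  rw [hlog]
  push_cast
  have : 24 * (4 * (⌈1 - q⌉ : ℝ))⁻¹ * -Real.log ε = (6 * -Real.log ε) / (⌈1 - q⌉ : ℝ) := by
    field_simp; ring
  rw [this, le_div_iff₀ hMp]
  nlinarith
end
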